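/- Let B be a finite structure over a finite relational signature σ, and suppose β₁,…,β_k are nonzero rational numbers and B₁,…,B_k are pairwise non-isomorphic finite σ-structures such that for every finite σ-structure A, Surjhom(A,B) = Σ_{i=1}^k β_i · hom(A,B_i). Then there exists an index i such that B_i is isomorphic to B and β_i = 1. -/

import Mathlib

/-- A finite relational signature: a finite set of relation symbols with arities. -/
structure Sig where
  symb : Type
  [fin : Finite symb]
  ar : symb → ℕ

attribute [instance] Sig.fin

/-- A finite structure over the signature `σ`. -/
structure Str (σ : Sig) where
  carrier : Type
  [fin : Finite carrier]
  rel : ∀ R : σ.symb, Set (Fin (σ.ar R) → carrier)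

attribute [instance] Str.fin

variable {σ : Sig}

/-- `h` is a homomorphism from `A` to `B`. -/
def IsHom (A B : Str σ) (h : A.carrier → B.carrier) : Prop :=
  ∀ R : σ.symb, ∀ t ∈ A.rel R, (h ∘ t) ∈ B.rel R

/-- `h` is a surjective homomorphism from `A` to `B`. -/
def IsSurjHom (A B : Str σ) (h : A.carrier → B.carrier) : Prop :=
  IsHom A B h ∧ Function.Surjective h

/-- `h` is a condensation from `A` to `B`. -/
def IsCondens (A B : Str σ) (h : A.carrier → B.carrier) : Prop :=
  IsSurjHom A B h ∧ ∀ R : σ.symb, (fun t => h ∘ t) '' A.rel R = B.rel R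

/-- The number of homomorphisms from `A` to `B`. -/
noncomputable def homCount (A B : Str σ) : ℕ := Nat.card {h : A.carrier → B.carrier // IsHom A B h}

/-- The number of surjective homomorphisms from `A` to `B`. -/
noncomputable def surjHomCount (A B : Str σ) : ℕ :=
  Nat.card {h : A.carrier → B.carrier // IsSurjHom A B h}

/-- The number of condensations from `A` to `B`. -/
noncomputable def condensCount (A B : Str σ) : ℕ :=
  Nat.card {h : A.carrier → B.carrier // IsCondens A B h}

/-- Isomorphism of structures. -/
def Iso (A B : Str σ) : Prop :=
  ∃ e : A.carrier ≃ B.carrier, ∀ (R : σ.symb) (t : Fin (σ.ar R) → A.carrier),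
    t ∈ A.rel R ↔ (⇑e ∘ t) ∈ B.rel R

/-- Homomorphic equivalence of structures. -/
def HomEquiv (A B : Str σ) : Prop :=
  (∃ h, IsHom A B h) ∧ (∃ h, IsHom B A h)

/-- The induced substructure of `B` on the subset `S`. -/
def induced (B : Str σ) (S : Set B.carrier) : Str σ where
  carrier := S
  rel R := {t | (fun i => (t i).val) ∈ B.rel R}

/-- The number of subsets `S` of the universe of `B` with `B[S]` isomorphic to `B'`. -/
noncomputable def indsubCount (B' B : Str σ) : ℕ :=
  Nat.card {S : Set B.carrier // Iso (induced B S) B'}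

/-- The deduct of `B` given by a family of subrelations `r`. -/
def deduct (B : Str σ) (r : ∀ R : σ.symb, Set (Fin (σ.ar R) → B.carrier)) : Str σ where
  carrier := B.carrier
  rel := r

/-- `C` is a deduct of `B`. -/
def IsDeductOf (C B : Str σ) : Prop :=
  ∃ r : ∀ R : σ.symb, Set (Fin (σ.ar R) → B.carrier),
    (∀ R, r R ⊆ B.rel R) ∧ C = deduct B r

/-- The number of deducts of `B` isomorphic to `B'`. -/
noncomputable def deductsCount (B' B : Str σ) : ℕ :=
  Nat.card {r : ∀ R : σ.symb, Set (Fin (σ.ar R) → B.carrier) //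
    (∀ R, r R ⊆ B.rel R) ∧ Iso (deduct B r) B'}

/-- The disjoint union of two structures. -/
def disjUnion (A₁ A₂ : Str σ) : Str σ where
  carrier := A₁.carrier ⊕ A₂.carrier
  rel R := (fun t => Sum.inl ∘ t) '' A₁.rel R ∪ (fun t => Sum.inr ∘ t) '' A₂.rel R

/-- The `N`-fold disjoint union of `A` with itself. -/
def nCopies (N : ℕ) (A : Str σ) : Str σ where
  carrier := Fin N × A.carrier
  rel R := {t | ∃ j : Fin N, ∃ s ∈ A.rel R, t = fun i => (j, s i)}

/-- The total size of a structure: universe size plus sizes of all relations. -/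
noncomputable def totalSize (B : Str σ) : ℕ :=
  Nat.card B.carrier + ∑ᶠ R : σ.symb, (B.rel R).ncard

/-- The number of homomorphisms from `A` to `C` whose range satisfies `Q`. -/
noncomputable def homCountOn (A C : Str σ) (Q : Set C.carrier → Prop) : ℕ :=
  Nat.card {h : A.carrier → C.carrier // IsHom A C h ∧ Q (Set.range h)}

/-- The number of injective homomorphisms from `A` to `C` whose range satisfies `Q`. -/
noncomputable def injCountOn (A C : Str σ) (Q : Set C.carrier → Prop) : ℕ :=
  Nat.card {h : A.carrier → C.carrier // (IsHom A C h ∧ Q (Set.range h)) ∧ Function.Injective h}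

/-- The quotient of a structure by an equivalence relation, with the image relations. -/
def quotStr (A : Str σ) (θ : Setoid A.carrier) : Str σ where
  carrier := Quotient θ
  rel R := (fun t => Quotient.mk θ ∘ t) '' A.rel R

/-- Composition with the quotient map identifies injective maps out of the quotient with maps whose
kernel is the given equivalence relation. -/
lemma card_ker_eq_injCountOn_quotStr (A C : Str σ) (Q : Set C.carrier → Prop)
    (θ : Setoid A.carrier) :
    Nat.card {h : {h : A.carrier → C.carrier // IsHom A C h ∧ Q (Set.range h)} //
      Setoid.ker h.1 = θ} = injCountOn (quotStr A θ) C Q := by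
  symm
  have hsurj : Function.Surjective (Quotient.mk θ) := Quotient.mk_surjective
  refine Nat.card_congr (Equiv.ofBijective
    (fun g => ⟨⟨g.1 ∘ Quotient.mk θ, ?_, ?_⟩, ?_⟩) ⟨?_, ?_⟩)
  · intro R t ht
    exact g.2.1.1 R _ ⟨t, ht, rfl⟩
  · exact (hsurj.range_comp g.1).symm ▸ g.2.1.2
  · ext a b
    rw [Setoid.ker_def]
    exact g.2.2.eq_iff.trans Quotient.eq
  · intro g g' hgg
    simp only [Subtype.mk.injEq] at hgg
    exact Subtype.ext (hsurj.injective_comp_right hgg)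
  · rintro ⟨⟨h, hh, hQ⟩, rfl⟩
    have hcomp : Quotient.lift h (fun _ _ hab => hab) ∘ Quotient.mk (Setoid.ker h) = h := rfl
    refine ⟨⟨Quotient.lift h (fun _ _ hab => hab), ⟨?_, ?_⟩, ?_⟩, rfl⟩
    · rintro R _ ⟨t, ht, rfl⟩
      exact hh R t ht
    · rw [← hcomp, hsurj.range_comp] at hQ
      exact hQ
    · exact fun a b => Quotient.inductionOn₂ a b fun _ _ hab => Quotient.sound hab

/-- Homomorphisms are counted by the injective homomorphisms from all quotients. -/
lemma homCountOn_eq_sum [∀ A : Str σ, Fintype (Setoid A.carrier)] (A C : Str σ)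
    (Q : Set C.carrier → Prop) :
    homCountOn A C Q = ∑ θ : Setoid A.carrier, injCountOn (quotStr A θ) C Q := by
  simp_rw [← card_ker_eq_injCountOn_quotStr, ← Nat.card_sigma]
  exact Nat.card_congr (Equiv.sigmaFiberEquiv _).symm

lemma injCountOn_quotStr_bot (A C : Str σ) (Q : Set C.carrier → Prop) :
    injCountOn (quotStr A ⊥) C Q = injCountOn A C Q := by
  rw [← card_ker_eq_injCountOn_quotStr]
  refine Nat.card_congr ((Equiv.subtypeSubtypeEquivSubtypeInter _
    (fun h : A.carrier → C.carrier => Setoid.ker h = ⊥)).trans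
    (Equiv.subtypeEquivRight fun h => ?_))
  rw [Setoid.injective_iff_ker_bot]

lemma card_quotient_lt {α : Type*} [Finite α] {θ : Setoid α} (hθ : θ ≠ ⊥) :
    Nat.card (Quotient θ) < Nat.card α := by
  refine lt_of_le_of_ne (Nat.card_le_card_of_surjective _ Quotient.mk_surjective) fun h => hθ ?_
  have hb := Function.Surjective.bijective_of_nat_card_le
    (Quotient.mk_surjective (s := θ)) h.ge
  rw [← Setoid.ker_mk_eq θ]
  exact (Setoid.injective_iff_ker_bot _).1 hb.injective

/-- A linear relation between homomorphism counts, valid for all sources, also holds for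
the counts of injective homomorphisms. -/
lemma injCountOn_eq_sum {ι : Type*} [Fintype ι] (B : Str σ) (Q : Set B.carrier → Prop)
    (β : ι → ℚ) (Bs : ι → Str σ) (P : ∀ i, Set (Bs i).carrier → Prop)
    (heq : ∀ A : Str σ, (homCountOn A B Q : ℚ) = ∑ i, β i * (homCountOn A (Bs i) (P i) : ℚ))
    (A : Str σ) :
    (injCountOn A B Q : ℚ) = ∑ i, β i * (injCountOn A (Bs i) (P i) : ℚ) := by
  classical
  have : ∀ A : Str σ, Fintype (Setoid A.carrier) := fun A =>
    have : Finite (Setoid A.carrier) := Finite.of_injective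
      (fun θ : Setoid A.carrier => θ.r) fun θ θ' h => Setoid.ext fun a b => by
        exact iff_of_eq (congrFun (congrFun h a) b)
    Fintype.ofFinite _
  induction hn : Nat.card A.carrier using Nat.strong_induction_on generalizing A with
  | _ n ih =>
    have h := heq A
    simp only [homCountOn_eq_sum, Nat.cast_sum, Finset.mul_sum] at h
    rw [Finset.sum_comm, ← Finset.add_sum_erase _ _ (Finset.mem_univ ⊥),
      ← Finset.add_sum_erase _ _ (Finset.mem_univ ⊥)] at h
    simp only [injCountOn_quotStr_bot] at h
    rw [Finset.sum_congr rfl fun θ hθ => ih _ (hn ▸ card_quotient_lt (Finset.ne_of_mem_erase hθ))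
      (quotStr A θ) rfl] at h
    exact add_right_cancel h

lemma IsHom.image_subset {A C : Str σ} {h : A.carrier → C.carrier} (hh : IsHom A C h)
    (R : σ.symb) : (fun t => h ∘ t) '' A.rel R ⊆ C.rel R := by
  rintro _ ⟨t, ht, rfl⟩
  exact hh R t ht

lemma IsHom.ncard_rel_le {A C : Str σ} {h : A.carrier → C.carrier} (hh : IsHom A C h)
    (hinj : Function.Injective h) (R : σ.symb) : (A.rel R).ncard ≤ (C.rel R).ncard := by
  rw [← Set.ncard_image_of_injective (A.rel R) hinj.comp_left]
  exact Set.ncard_le_ncard (hh.image_subset R)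

lemma IsHom.totalSize_le {A C : Str σ} {h : A.carrier → C.carrier} (hh : IsHom A C h)
    (hinj : Function.Injective h) : totalSize A ≤ totalSize C := by
  have := Fintype.ofFinite σ.symb
  simp only [totalSize, finsum_eq_sum_of_fintype]
  exact add_le_add (Nat.card_le_card_of_injective h hinj)
    (Finset.sum_le_sum fun R _ => hh.ncard_rel_le hinj R)

/-- An injective homomorphism into a structure that is not larger is an isomorphism. -/
lemma IsHom.iso_of_totalSize_le {A C : Str σ} {h : A.carrier → C.carrier} (hh : IsHom A C h)
    (hinj : Function.Injective h) (hs : totalSize C ≤ totalSize A) : Iso A C := by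
  have := Fintype.ofFinite σ.symb
  have hc := Nat.card_le_card_of_injective h hinj
  have hr : ∑ R, (A.rel R).ncard ≤ ∑ R, (C.rel R).ncard :=
    Finset.sum_le_sum fun R _ => hh.ncard_rel_le hinj R
  simp only [totalSize, finsum_eq_sum_of_fintype] at hs
  have hcards := (Finset.sum_eq_sum_iff_of_le fun R _ => hh.ncard_rel_le hinj R).1
    (le_antisymm hr (by lia))
  refine ⟨Equiv.ofBijective h (hinj.bijective_of_nat_card_le (by lia)), fun R t =>
    ⟨hh R t, fun ht => ?_⟩⟩
  have himg : (fun t => h ∘ t) '' A.rel R = C.rel R := by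
    refine Set.eq_of_subset_of_ncard_le (hh.image_subset R) ?_
    rw [Set.ncard_image_of_injective (A.rel R) hinj.comp_left, hcards R (Finset.mem_univ R)]
  change h ∘ t ∈ C.rel R at ht
  rw [← himg] at ht
  exact (hinj.comp_left.mem_set_image).1 ht

lemma Iso.symm {A C : Str σ} : Iso A C → Iso C A := by
  rintro ⟨e, he⟩
  refine ⟨e.symm, fun R t => ?_⟩
  rw [he, ← Function.comp_assoc, e.self_comp_symm, Function.id_comp]

lemma Iso.trans {A C D : Str σ} : Iso A C → Iso C D → Iso A D := by
  rintro ⟨e, he⟩ ⟨f, hf⟩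
  exact ⟨e.trans f, fun R t => (he R t).trans (hf R _)⟩

lemma injCountOn_congr_right {A C D : Str σ} (hCD : Iso C D) :
    injCountOn A C (fun _ => True) = injCountOn A D (fun _ => True) := by
  obtain ⟨e, he⟩ := hCD
  refine Nat.card_congr (Equiv.subtypeEquiv (Equiv.arrowCongr (Equiv.refl _) e) fun h => ?_)
  refine and_congr (and_congr_left' ?_) (e.comp_injective h).symm
  exact forall_congr' fun R => forall₂_congr fun t _ => he R (h ∘ t)

lemma injCountOn_self_surj (B : Str σ) :
    injCountOn B B (· = Set.univ) = injCountOn B B (fun _ => True) := by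
  refine Nat.card_congr (Equiv.subtypeEquivRight fun h => ?_)
  refine and_congr_left fun hinj => and_congr_right fun _ => ?_
  simpa [Set.range_eq_univ] using Finite.surjective_of_injective hinj

lemma injCountOn_self_pos (B : Str σ) : 0 < injCountOn B B (fun _ => True) := by
  have : Nonempty {h : B.carrier → B.carrier // (IsHom B B h ∧ True) ∧ Function.Injective h} :=
    ⟨⟨id, ⟨fun _ _ ht => ht, trivial⟩, Function.injective_id⟩⟩
  exact Nat.card_pos

lemma exists_of_injCountOn_ne_zero {A C : Str σ} {Q : Set C.carrier → Prop}
    (h : injCountOn A C Q ≠ 0) : ∃ f, IsHom A C f ∧ Function.Injective f := by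
  obtain ⟨⟨f, hf⟩⟩ := (Nat.card_ne_zero.1 h).1
  exact ⟨f, hf.1.1, hf.2⟩

/-- in any expression of Surjhom(·,B) as a linear combination of
homomorphism-counting functions, hom(·,B) occurs with coefficient 1. -/
theorem stmt_13 (σ : Sig) (B : Str σ) (k : ℕ) (β : Fin k → ℚ) (Bs : Fin k → Str σ)
    (hβ : ∀ i, β i ≠ 0)
    (hB : ∀ i j, i ≠ j → ¬ Iso (Bs i) (Bs j))
    (heq : ∀ A : Str σ, (surjHomCount A B : ℚ) = ∑ i, β i * (homCount A (Bs i) : ℚ)) :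
    ∃ i, Iso (Bs i) B ∧ β i = 1 := by
  have key := injCountOn_eq_sum B (· = Set.univ) β Bs (fun _ _ => True) fun A => by
    simpa [homCountOn, homCount, surjHomCount, IsSurjHom, Set.range_eq_univ] using heq A
  have hpos : (injCountOn B B (fun _ => True) : ℚ) ≠ 0 := by
    exact_mod_cast (injCountOn_self_pos B).ne'
  have hBB := key B
  rw [injCountOn_self_surj] at hBB
  obtain ⟨i, -, hi⟩ := Finset.exists_ne_zero_of_sum_ne_zero (hBB ▸ hpos)
  obtain ⟨f, hf, hfi⟩ := exists_of_injCountOn_ne_zero (Nat.cast_ne_zero.1 (right_ne_zero_of_mul hi))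
  have : Nonempty (Fin k) := ⟨i⟩
  obtain ⟨m, hm⟩ := Finite.exists_max fun j => totalSize (Bs j)
  have hmB : totalSize (Bs m) ≤ totalSize B := by
    have hne : (injCountOn (Bs m) B (· = Set.univ) : ℚ) ≠ 0 := by
      rw [key, Finset.sum_eq_single m]
      · exact mul_ne_zero (hβ m) (by exact_mod_cast (injCountOn_self_pos (Bs m)).ne')
      · intro j _ hj
        by_contra hne
        obtain ⟨g, hg, hgi⟩ :=
          exists_of_injCountOn_ne_zero (Nat.cast_ne_zero.1 (right_ne_zero_of_mul hne))
        exact hB m j hj.symm (hg.iso_of_totalSize_le hgi (hm j))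
      · simp
    obtain ⟨g, hg, hgi⟩ := exists_of_injCountOn_ne_zero (Nat.cast_ne_zero.1 hne)
    exact hg.totalSize_le hgi
  have hiso : Iso B (Bs i) := hf.iso_of_totalSize_le hfi ((hm i).trans hmB)
  refine ⟨i, hiso.symm, ?_⟩
  rw [Finset.sum_eq_single i, ← injCountOn_congr_right hiso] at hBB
  · exact (mul_eq_right₀ hpos).1 hBB.symm
  · intro j _ hj
    by_contra hne
    obtain ⟨g, hg, hgi⟩ :=
      exists_of_injCountOn_ne_zero (Nat.cast_ne_zero.1 (right_ne_zero_of_mul hne))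
    exact hB j i hj ((hg.iso_of_totalSize_le hgi ((hm j).trans hmB)).symm.trans hiso)
  · simp
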